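/- Let 0 < p, q < ∞ with p ≤ q and p ≤ 1, and let u, v, w be weights on (a,b). Then there exists a finite constant C > 0 such that the inequality (∫_a^b (∫_a^x f(s) u(s) ds)^q w(x) dx)^{1/q} ≤ C (∫_a^b f(x)^p v(x) dx)^{1/p} holds for all non-decreasing f ∈ 𝔐↑(a,b) if and only if 𝒞₁ := ess sup_{x∈(a,b)} (∫_x^b w(t) (∫_x^t u)^q dt)^{1/q} (∫_x^b v)^{-1/p} < ∞. Moreover, the best constant C in the inequality satisfies C ≈ 𝒞₁. -/

import Mathlib

open MeasureTheory Set ENNReal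

noncomputable section

/-- The open interval `(a, b)` with extended-real endpoints, viewed as a set of reals. -/
def io (a b : EReal) : Set ℝ := {x : ℝ | a < (x : EReal) ∧ (x : EReal) < b}

/-- A weight on `(a, b)`: a measurable function which is positive and finite on `(a, b)`. -/
def IsWeight (a b : EReal) (u : ℝ → ℝ≥0∞) : Prop :=
  Measurable u ∧ ∀ x ∈ io a b, 0 < u x ∧ u x < ⊤

/-- The left-hand side of the Hardy inequality for non-decreasing functions. -/
def lhsMon (a b : EReal) (q : ℝ) (u w f : ℝ → ℝ≥0∞) : ℝ≥0∞ :=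
  (∫⁻ x in io a b, (∫⁻ s in io a x, f s * u s) ^ q * w x) ^ (1 / q)

/-- The right-hand side (without the constant) of the inequality. -/
def rhsNorm (a b : EReal) (p : ℝ) (v f : ℝ → ℝ≥0∞) : ℝ≥0∞ :=
  (∫⁻ x in io a b, f x ^ p * v x) ^ (1 / p)

/-- The best constant in the Hardy inequality restricted to non-negative
non-decreasing functions. -/
def bestMon (a b : EReal) (p q : ℝ) (u v w : ℝ → ℝ≥0∞) : ℝ≥0∞ :=
  sInf {C : ℝ≥0∞ | ∀ f : ℝ → ℝ≥0∞, Measurable f → MonotoneOn f (io a b) →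
    lhsMon a b q u w f ≤ C * rhsNorm a b p v f}

/-- The constant `𝒞₁`. -/
def CC1 (a b : EReal) (p q : ℝ) (u v w : ℝ → ℝ≥0∞) : ℝ≥0∞ :=
  essSup (fun x : ℝ =>
      (∫⁻ t in io x b, w t * (∫⁻ s in io x t, u s) ^ q) ^ (1 / q) *
        (∫⁻ t in io x b, v t) ^ (-(1 / p)))
    (volume.restrict (io a b))

section Minkowski

variable {α β : Type*} [MeasurableSpace α] [MeasurableSpace β]

/-- The duality step of Minkowski's integral inequality: the bound holds for every minorant of
the inner integral which lies in `L^r`. -/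
lemma lintegral_rpow_le_of_le_lintegral {μ : Measure α} {ν : Measure β} [SFinite μ] [SFinite ν]
    {F : α → β → ℝ≥0∞} (hF : Measurable (Function.uncurry F)) {r : ℝ} (hr : 1 < r)
    {h : α → ℝ≥0∞} (hh : Measurable h) (hle : ∀ x, h x ≤ ∫⁻ y, F x y ∂ν)
    (hfin : ∫⁻ x, h x ^ r ∂μ ≠ ⊤) :
    ∫⁻ x, h x ^ r ∂μ ≤ (∫⁻ y, (∫⁻ x, F x y ^ r ∂μ) ^ (1 / r) ∂ν) ^ r := by
  have hr0 : 0 < r := by linarith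
  set I := ∫⁻ x, h x ^ r ∂μ with hI
  set N := ∫⁻ y, (∫⁻ x, F x y ^ r ∂μ) ^ (1 / r) ∂ν with hN
  have hconj : r.HolderConjugate (r / (r - 1)) := Real.HolderConjugate.conjExponent hr
  have hexp : (r - 1) * (r / (r - 1)) = r := by
    field_simp [(sub_pos.2 hr).ne']
  have hFy : ∀ y, Measurable fun x => F x y := fun y => hF.of_uncurry_right
  have key : I ≤ N * I ^ (1 - 1 / r) := by
    calc I ≤ ∫⁻ x, ∫⁻ y, h x ^ (r - 1) * F x y ∂ν ∂μ := by
          refine lintegral_mono fun x => ?_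
          rw [lintegral_const_mul _ hF.of_uncurry_left]
          calc h x ^ r = h x ^ (r - 1) * h x ^ (1 : ℝ) := by
                rw [← ENNReal.rpow_add_of_nonneg _ _ (by linarith) zero_le_one]; simp
            _ ≤ _ := by rw [ENNReal.rpow_one]; gcongr; exact hle x
      _ = ∫⁻ y, ∫⁻ x, h x ^ (r - 1) * F x y ∂μ ∂ν := by
          refine lintegral_lintegral_swap (Measurable.aemeasurable ?_)
          exact ((hh.comp measurable_fst).pow_const _).mul hF
      _ ≤ ∫⁻ y, (∫⁻ x, F x y ^ r ∂μ) ^ (1 / r) * I ^ (1 - 1 / r) ∂ν := by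
          refine lintegral_mono fun y => ?_
          have := ENNReal.lintegral_mul_le_Lp_mul_Lq μ hconj (hFy y).aemeasurable
            (hh.pow_const (r - 1)).aemeasurable
          simp only [Pi.mul_apply, ← ENNReal.rpow_mul, hexp] at this
          have e : 1 / (r / (r - 1)) = 1 - 1 / r := by field_simp
          rw [e] at this
          simpa only [mul_comm (F _ y)] using this
      _ = N * I ^ (1 - 1 / r) := by
          rw [lintegral_mul_const]
          exact (Measurable.lintegral_prod_left' (f := fun z : α × β => F z.1 z.2 ^ r)
            (hF.pow_const r)).pow_const _
  rcases eq_or_ne I 0 with h0 | h0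
  · rw [h0]; exact zero_le
  have hroot : I ^ (1 / r) ≤ N := by
    have hsplit : I = I ^ (1 / r) * I ^ (1 - 1 / r) := by
      rw [← ENNReal.rpow_add _ _ h0 hfin]; simp
    have hz : I ^ (1 - 1 / r) ≠ 0 := by simp [ENNReal.rpow_eq_zero_iff, h0, hfin]
    have ht : I ^ (1 - 1 / r) ≠ ⊤ := by simp [ENNReal.rpow_eq_top_iff, h0, hfin]
    refine (ENNReal.mul_le_mul_iff_left hz ht).1 ?_
    rwa [← hsplit]
  calc I = (I ^ (1 / r)) ^ r := by rw [← ENNReal.rpow_mul]; simp [hr0.ne']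
    _ ≤ N ^ r := by gcongr

/-- **Minkowski's integral inequality**. -/
lemma lintegral_lintegral_rpow_le {μ : Measure α} {ν : Measure β} [SigmaFinite μ] [SFinite ν]
    {F : α → β → ℝ≥0∞} (hF : Measurable (Function.uncurry F)) {r : ℝ} (hr : 1 ≤ r) :
    ∫⁻ x, (∫⁻ y, F x y ∂ν) ^ r ∂μ ≤ (∫⁻ y, (∫⁻ x, F x y ^ r ∂μ) ^ (1 / r) ∂ν) ^ r := by
  rcases hr.eq_or_lt with rfl | hr
  · simp only [ENNReal.rpow_one, div_one]
    exact (lintegral_lintegral_swap hF.aemeasurable).le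
  have hr0 : 0 < r := by linarith
  set H := fun x => ∫⁻ y, F x y ∂ν with hH
  have hHm : Measurable H := hF.lintegral_prod_right'
  set h : ℕ → α → ℝ≥0∞ := fun n => (spanningSets μ n).indicator fun x => min (H x) n with hh
  have hhm : ∀ n, Measurable (h n) := fun n =>
    (hHm.min measurable_const).indicator (measurableSet_spanningSets μ n)
  have hmono : ∀ x, Monotone fun n => h n x := by
    intro x m n hmn
    simp only [hh]
    refine (indicator_le_indicator_of_subset (monotone_spanningSets μ hmn)
      (fun _ => zero_le) x).trans (indicator_le_indicator ?_)
    gcongr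
  have hlim : ∀ x, Filter.Tendsto (fun n => h n x) Filter.atTop (nhds (H x)) := by
    intro x
    have h1 : Filter.Tendsto (fun n : ℕ => min (H x) (n : ℝ≥0∞)) Filter.atTop
        (nhds (min (H x) ⊤)) := tendsto_const_nhds.min ENNReal.tendsto_nat_nhds_top
    rw [min_eq_left le_top] at h1
    refine h1.congr' ?_
    filter_upwards [Filter.eventually_ge_atTop (spanningSetsIndex μ x)] with n hn
    have : x ∈ spanningSets μ n := mem_spanningSets_of_index_le μ x hn
    simp [hh, this]
  have hT := lintegral_tendsto_of_tendsto_of_monotone (μ := μ) (f := fun n x => h n x ^ r)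
    (F := fun x => H x ^ r) (fun n => ((hhm n).pow_const r).aemeasurable)
    (ae_of_all _ fun x m n hmn => ENNReal.rpow_le_rpow (hmono x hmn) hr0.le)
    (ae_of_all _ fun x => (ENNReal.continuous_rpow_const.tendsto _).comp (hlim x))
  refine le_of_tendsto' hT fun n => lintegral_rpow_le_of_le_lintegral hF hr (hhm n) ?_ ?_
  · intro x
    exact indicator_le (fun x _ => min_le_left _ _) x
  · have : ∫⁻ x, h n x ^ r ∂μ ≤ ∫⁻ x in spanningSets μ n, (n : ℝ≥0∞) ^ r ∂μ := by
      rw [← lintegral_indicator (measurableSet_spanningSets μ n)]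
      refine lintegral_mono fun x => ?_
      by_cases hx : x ∈ spanningSets μ n
      · simp only [hh, indicator_of_mem hx]
        gcongr
        exact min_le_right _ _
      · simp [hh, indicator_of_notMem hx, hr0]
    refine (this.trans_lt ?_).ne
    rw [setLIntegral_const]
    exact ENNReal.mul_lt_top (ENNReal.rpow_lt_top_of_nonneg hr0.le (ENNReal.natCast_ne_top n))
      (measure_spanningSets_lt_top μ n)

/-- Minkowski's integral inequality for a weight which is finite on a set. -/
lemma setLIntegral_lintegral_rpow_mul_le {μ : Measure α} {ν : Measure β} [SigmaFinite μ]
    [SFinite ν] {F : α → β → ℝ≥0∞} (hF : Measurable (Function.uncurry F)) {r : ℝ} (hr : 1 ≤ r)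
    {S : Set α} (hS : MeasurableSet S) {w : α → ℝ≥0∞} (hw : Measurable w)
    (hwS : ∀ x ∈ S, w x ≠ ⊤) :
    ∫⁻ x in S, (∫⁻ y, F x y ∂ν) ^ r * w x ∂μ ≤
      (∫⁻ y, (∫⁻ x in S, F x y ^ r * w x ∂μ) ^ (1 / r) ∂ν) ^ r := by
  have : SigmaFinite ((μ.restrict S).withDensity w) :=
    SigmaFinite.withDensity_of_ne_top (ae_restrict_of_forall_mem hS hwS)
  have key := lintegral_lintegral_rpow_le (μ := (μ.restrict S).withDensity w) (ν := ν) hF hr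
  have hHm : Measurable fun x => ∫⁻ y, F x y ∂ν := hF.lintegral_prod_right'
  rw [lintegral_withDensity_eq_lintegral_mul _ hw (hHm.pow_const r)] at key
  have e : ∀ y, ∫⁻ x, F x y ^ r ∂(μ.restrict S).withDensity w = ∫⁻ x in S, F x y ^ r * w x ∂μ := by
    intro y
    rw [lintegral_withDensity_eq_lintegral_mul _ hw (hF.of_uncurry_right.pow_const r)]
    simp only [Pi.mul_apply, mul_comm]
  simpa only [e, Pi.mul_apply, mul_comm (w _)] using key

end Minkowski

/-- The layer cake formula at a point. -/
lemma lintegral_Ioi_ite_ofReal_lt (g : ℝ≥0∞) :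
    ∫⁻ l in Ioi (0 : ℝ), (if ENNReal.ofReal l < g then 1 else 0) = g := by
  have hm : MeasurableSet {l : ℝ | ENNReal.ofReal l < g} :=
    measurableSet_lt ENNReal.measurable_ofReal measurable_const
  have : (fun l : ℝ => if ENNReal.ofReal l < g then (1 : ℝ≥0∞) else 0) =
      {l : ℝ | ENNReal.ofReal l < g}.indicator 1 := by
    ext l; simp [indicator_apply]
  rw [this, lintegral_indicator_one hm, Measure.restrict_apply hm]
  rcases eq_or_ne g ⊤ with rfl | hg
  · simp
  · have : {l : ℝ | ENNReal.ofReal l < g} ∩ Ioi 0 = Ioo 0 g.toReal := by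
      ext l
      simp only [mem_inter_iff, mem_ofPred_eq, mem_Ioi, mem_Ioo]
      constructor
      · rintro ⟨h1, h2⟩; exact ⟨h2, (ENNReal.ofReal_lt_iff_lt_toReal h2.le hg).1 h1⟩
      · rintro ⟨h1, h2⟩; exact ⟨(ENNReal.ofReal_lt_iff_lt_toReal h1.le hg).2 h2, h1⟩
    rw [this, Real.volume_Ioo, sub_zero, ENNReal.ofReal_toReal hg]

lemma measurableSet_io (a b : EReal) : MeasurableSet (io a b) :=
  measurable_coe_real_ereal measurableSet_Ioo

lemma isOpen_io (a b : EReal) : IsOpen (io a b) :=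
  isOpen_Ioo.preimage continuous_coe_real_ereal

lemma nonempty_io {a b : EReal} (h : a < b) : (io a b).Nonempty := by
  obtain ⟨x, hx1, hx2⟩ := EReal.lt_iff_exists_real_btwn.1 h
  exact ⟨x, hx1, hx2⟩

lemma volume_io_ne_zero {a b : EReal} (h : a < b) : volume (io a b) ≠ 0 :=
  ((isOpen_io a b).measure_pos volume (nonempty_io h)).ne'

lemma io_subset_io {a b a' b' : EReal} (ha : a' ≤ a) (hb : b ≤ b') : io a b ⊆ io a' b' :=
  fun _ hx => ⟨ha.trans_lt hx.1, hx.2.trans_le hb⟩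

/-- The integral of a function positive on `(x, b)` does not vanish. -/
lemma setLIntegral_io_ne_zero {x b : EReal} (h : x < b) {v : ℝ → ℝ≥0∞} (hv : Measurable v)
    (hpos : ∀ t ∈ io x b, 0 < v t) : ∫⁻ t in io x b, v t ≠ 0 := by
  refine ((setLIntegral_pos_iff hv).2 ?_).ne'
  have : Function.support v ∩ io x b = io x b :=
    inter_eq_right.2 fun t ht => (hpos t ht).ne'
  rw [this]
  exact (volume_io_ne_zero h).bot_lt

/-- A property valid almost everywhere on `(a, b)` holds along a sequence of reals decreasing to
any given `x ∈ [a, b)`. -/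
lemma exists_seq_io_of_ae {a b x : EReal} (hax : a ≤ x) (hxb : x < b) {P : ℝ → Prop}
    (hP : ∀ᵐ y ∂volume.restrict (io a b), P y) :
    ∃ z : ℕ → ℝ, Antitone z ∧ (∀ n, z n ∈ io x b) ∧ (∀ n, P (z n)) ∧
      Filter.Tendsto (fun n => (z n : EReal)) Filter.atTop (nhds x) := by
  obtain ⟨y, hy, hyb, hyx⟩ := exists_seq_strictAnti_tendsto' hxb
  have hex : ∀ n, ∃ z : ℝ, z ∈ io (y (n + 1)) (y n) ∧ P z := by
    intro n
    have hsub : io (y (n + 1)) (y n) ⊆ io a b :=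
      io_subset_io (hax.trans (hyb _).1.le) (hyb _).2.le
    have hP' := ae_restrict_of_ae_restrict_of_subset hsub hP
    have hne : NeZero (volume.restrict (io (y (n + 1)) (y n))) :=
      ⟨by rw [Ne, Measure.restrict_eq_zero]; exact volume_io_ne_zero (hy n.lt_succ_self)⟩
    have : (ae (volume.restrict (io (y (n + 1)) (y n)))).NeBot := inferInstance
    exact ((ae_restrict_mem (measurableSet_io _ _)).and hP').exists
  choose z hz hPz using hex
  refine ⟨z, antitone_nat_of_succ_le fun n => ?_, fun n => ?_, hPz, ?_⟩
  · exact_mod_cast ((hz (n + 1)).2.trans (hz n).1).le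
  · exact ⟨(hyb _).1.trans (hz n).1, (hz n).2.trans (hyb _).2⟩
  · exact tendsto_of_tendsto_of_tendsto_of_le_of_le tendsto_const_nhds hyx
      (fun n => ((hyb _).1.trans (hz n).1).le) (fun n => (hz n).2.le)

/-- The pointwise inequality defining `CC1`, solved for the weighted Hardy integral. -/
lemma le_of_rpow_mul_rpow_neg_le {p q : ℝ} (hp : 0 < p) (hq : 0 < q) {I V K : ℝ≥0∞}
    (hK : 0 < K) (hV : V ≠ 0) (h : I ^ (1 / q) * V ^ (-(1 / p)) ≤ K) :
    I ≤ (K ^ p * V) ^ (q / p) := by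
  rcases eq_or_ne V ⊤ with rfl | hVt
  · rw [ENNReal.mul_top (by simp [ENNReal.rpow_eq_zero_iff, hK.ne', hp.not_gt]),
      ENNReal.top_rpow_of_pos (by positivity)]
    exact le_top
  · rw [ENNReal.rpow_neg, ← div_eq_mul_inv, ENNReal.div_le_iff
      (by simp [ENNReal.rpow_eq_zero_iff, hV, hVt]) (by simp [ENNReal.rpow_eq_top_iff, hV, hVt])] at h
    calc I = (I ^ (1 / q)) ^ q := by rw [← ENNReal.rpow_mul]; simp [hq.ne']
      _ ≤ (K * V ^ (1 / p)) ^ q := by gcongr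
      _ = _ := by
        rw [ENNReal.mul_rpow_of_nonneg _ _ hq.le,
          ENNReal.mul_rpow_of_nonneg _ _ (by positivity : 0 ≤ q / p), ← ENNReal.rpow_mul,
          ← ENNReal.rpow_mul]
        congr 2 <;> field_simp

/-- The Hardy inequality for the indicator of an upper subset of `(a, b)`. -/
lemma hardy_indicator_le {a b : EReal} {p q : ℝ} (hp : 0 < p) (hq : 0 < q)
    {u v w : ℝ → ℝ≥0∞} (hu : IsWeight a b u) (hv : IsWeight a b v) (hw : IsWeight a b w)
    {K : ℝ≥0∞} (hK : 0 < K) (hCK : CC1 a b p q u v w ≤ K) {φ : ℝ → ℝ≥0∞}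
    (hφ01 : ∀ s, φ s = 0 ∨ φ s = 1) (hφ : MonotoneOn φ (io a b)) :
    ∫⁻ t in io a b, (∫⁻ s in io a t, φ s * u s) ^ q * w t ≤
      (K ^ p * ∫⁻ s in io a b, φ s * v s) ^ (q / p) := by
  by_cases hne : ∃ s ∈ io a b, φ s = 1
  swap
  · push Not at hne
    have h0 : ∀ s ∈ io a b, φ s = 0 := fun s hs => (hφ01 s).resolve_right (hne s hs)
    refine le_of_eq_of_le ?_ zero_le
    refine (setLIntegral_congr_fun (g := fun _ => 0) (measurableSet_io a b) fun t ht => ?_).trans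
      (by simp)
    have : ∫⁻ s in io a t, φ s * u s = 0 := by
      refine (setLIntegral_congr_fun (g := fun _ => 0) (measurableSet_io a t) fun s hs => ?_).trans
        (by simp)
      simp [h0 s (io_subset_io le_rfl ht.2.le hs)]
    simp [this, hq]
  set E : Set EReal := (fun s : ℝ => (s : EReal)) '' {s | s ∈ io a b ∧ φ s = 1} with hE
  set x := sInf E with hx
  have hax : a ≤ x := le_sInf (by rintro _ ⟨s, hs, rfl⟩; exact hs.1.1.le)
  have hxle : ∀ s ∈ io a b, φ s = 1 → x ≤ s := fun s hs h => sInf_le ⟨s, ⟨hs, h⟩, rfl⟩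
  have hxb : x < b := by
    obtain ⟨s, hs, h⟩ := hne
    exact (hxle s hs h).trans_lt hs.2
  have hone : ∀ s ∈ io x b, φ s = 1 := by
    intro s hs
    obtain ⟨_, ⟨r, hr, rfl⟩, hrs⟩ := sInf_lt_iff.1 hs.1
    have : φ r ≤ φ s := hφ hr.1 (io_subset_io hax le_rfl hs) (EReal.coe_le_coe_iff.1 hrs.le)
    rw [hr.2] at this
    exact (hφ01 s).resolve_left fun h => by simp [h] at this
  obtain ⟨z, hz, hzb, hPz, hzx⟩ := exists_seq_io_of_ae hax hxb
    (ENNReal.ae_le_essSup (μ := volume.restrict (io a b)) fun x : ℝ =>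
      (∫⁻ t in io x b, w t * (∫⁻ s in io x t, u s) ^ q) ^ (1 / q) *
        (∫⁻ t in io x b, v t) ^ (-(1 / p)))
  set χ : ℕ → ℝ → ℝ≥0∞ := fun n s => if z n < s then 1 else 0 with hχ
  have hχm : ∀ n, Measurable (χ n) := fun n =>
    Measurable.ite measurableSet_Ioi measurable_const measurable_const
  have hχmono : ∀ s, Monotone fun n => χ n s := by
    intro s m n hmn
    simp only [hχ]
    split_ifs with h1 h2
    · exact le_rfl
    · exact absurd ((hz hmn).trans_lt h1) h2
    · exact zero_le
    · exact le_rfl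
  have hχlim : ∀ s ∈ io a b, (s : EReal) ≠ x →
      Filter.Tendsto (fun n => χ n s) Filter.atTop (nhds (φ s)) := by
    intro s hs hsx
    rcases lt_or_gt_of_ne hsx with h | h
    · have h0 : φ s = 0 := (hφ01 s).resolve_right fun h1 => (hxle s hs h1).not_gt h
      have : (fun n => χ n s) = fun _ => φ s := by
        ext n
        have : ¬ z n < s := fun hn => by
          have h2 : (z n : EReal) < s := by exact_mod_cast hn
          exact ((hzb n).1.trans h2).not_gt h
        simp [hχ, this, h0]
      rw [this]; exact tendsto_const_nhds
    · refine tendsto_const_nhds.congr' ?_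
      filter_upwards [hzx.eventually (gt_mem_nhds h)] with n hn
      have : z n < s := by exact_mod_cast hn
      simp [hχ, this, hone s ⟨h, hs.2⟩]
  have hnull : ∀ᵐ s : ℝ, (s : EReal) ≠ x := by
    rw [ae_iff]
    refine Set.Subsingleton.measure_zero ?_ _
    intro s hs r hr
    simp only [ne_eq, not_not, mem_ofPred_eq] at hs hr
    exact_mod_cast hs.trans hr.symm
  set B : ℕ → ℝ → ℝ≥0∞ := fun n t => ∫⁻ s in io a t, χ n s * u s with hB
  have hBm : ∀ n, Measurable (B n) := fun n => Monotone.measurable fun t t' htt =>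
    lintegral_mono_set (io_subset_io le_rfl (by exact_mod_cast htt))
  have hBmono : ∀ t, Monotone fun n => B n t := fun t m n hmn =>
    lintegral_mono fun s => mul_le_mul_left (hχmono s hmn) _
  have hBlim : ∀ t ∈ io a b, Filter.Tendsto (fun n => B n t) Filter.atTop
      (nhds (∫⁻ s in io a t, φ s * u s)) := by
    intro t ht
    refine lintegral_tendsto_of_tendsto_of_monotone
      (fun n => ((hχm n).mul hu.1).aemeasurable)
      (ae_of_all _ fun s m n hmn => mul_le_mul_left (hχmono s hmn) _) ?_
    filter_upwards [ae_restrict_mem (measurableSet_io a t), ae_restrict_of_ae hnull] with s hs hsx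
    have hs' := io_subset_io le_rfl ht.2.le hs
    exact ENNReal.Tendsto.mul_const (hχlim s hs' hsx) (Or.inr (hu.2 s hs').2.ne)
  have hT := lintegral_tendsto_of_tendsto_of_monotone (μ := volume.restrict (io a b))
    (f := fun n t => B n t ^ q * w t) (F := fun t => (∫⁻ s in io a t, φ s * u s) ^ q * w t)
    (fun n => (((hBm n).pow_const q).mul hw.1).aemeasurable)
    (ae_of_all _ fun t m n hmn =>
      mul_le_mul_left (ENNReal.rpow_le_rpow (hBmono t hmn) hq.le) _)
    (by
      filter_upwards [ae_restrict_mem (measurableSet_io a b)] with t ht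
      exact ENNReal.Tendsto.mul_const
        ((ENNReal.continuous_rpow_const.tendsto _).comp (hBlim t ht)) (Or.inr (hw.2 t ht).2.ne))
  refine le_of_tendsto' hT fun n => ?_
  have hzab := io_subset_io (b := b) (hax.trans (hzb n).1.le) le_rfl
  have hBle : ∀ t, B n t ≤ ∫⁻ s in io (z n) t, u s := by
    intro t
    simp only [hB]
    rw [← lintegral_indicator (measurableSet_io _ _), ← lintegral_indicator (measurableSet_io _ _)]
    refine lintegral_mono fun s => ?_
    by_cases hs : s ∈ io a t
    · by_cases hzs : z n < s
      · have : s ∈ io (z n) t := ⟨by exact_mod_cast hzs, hs.2⟩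
        simp [hχ, hs, hzs, this]
      · simp [hχ, hs, hzs]
    · simp [hs]
  have hI : ∫⁻ t in io a b, B n t ^ q * w t ≤
      ∫⁻ t in io (z n) b, w t * (∫⁻ s in io (z n) t, u s) ^ q := by
    rw [← lintegral_indicator (measurableSet_io _ _), ← lintegral_indicator (measurableSet_io _ _)]
    refine lintegral_mono fun t => ?_
    by_cases ht : t ∈ io a b
    · by_cases hzt : z n < t
      · have : t ∈ io (z n) b := ⟨by exact_mod_cast hzt, ht.2⟩
        simp only [indicator_of_mem ht, indicator_of_mem this]
        rw [mul_comm]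
        gcongr
        exact hBle t
      · have h0 : B n t = 0 := by
          have hem : io (z n) t = ∅ := by
            ext s
            simp only [mem_empty_iff_false, iff_false]
            intro hs
            exact hzt (by exact_mod_cast hs.1.trans hs.2)
          have := hBle t
          rw [hem] at this
          simpa using this
        simp [ht, h0, hq]
    · simp [ht]
  refine hI.trans ((le_of_rpow_mul_rpow_neg_le hp hq hK ?_ ((hPz n).trans hCK)).trans ?_)
  · exact setLIntegral_io_ne_zero (hzb n).2 hv.1 fun t ht => (hv.2 t (hzab ht)).1
  · refine ENNReal.rpow_le_rpow (mul_le_mul_right ?_ _) (by positivity)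
    calc ∫⁻ t in io (z n) b, v t = ∫⁻ t in io (z n) b, φ t * v t :=
          setLIntegral_congr_fun (measurableSet_io _ _) fun t ht => by
            simp [hone t (io_subset_io (hzb n).1.le le_rfl ht)]
      _ ≤ _ := lintegral_mono_set hzab

/-- Sufficiency: any positive constant dominating `CC1` is admissible. -/
lemma lhsMon_le_mul_rhsNorm {a b : EReal} {p q : ℝ} (hp : 0 < p) (hq : 0 < q) (hpq : p ≤ q)
    (hp1 : p ≤ 1) {u v w : ℝ → ℝ≥0∞} (hu : IsWeight a b u) (hv : IsWeight a b v)
    (hw : IsWeight a b w) {K : ℝ≥0∞} (hK : 0 < K) (hCK : CC1 a b p q u v w ≤ K)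
    {f : ℝ → ℝ≥0∞} (hfm : Measurable f) (hf : MonotoneOn f (io a b)) :
    lhsMon a b q u w f ≤ K * rhsNorm a b p v f := by
  set ν : Measure ℝ := volume.restrict (Ioi 0) with hν
  set F : ℝ → ℝ → ℝ≥0∞ := fun s l => if ENNReal.ofReal l < f s ^ p then 1 else 0 with hF
  have hFm : Measurable (Function.uncurry F) := by
    refine Measurable.ite (measurableSet_lt ?_ ?_) measurable_const measurable_const
    · exact ENNReal.measurable_ofReal.comp measurable_snd
    · exact (hfm.comp measurable_fst).pow_const p
  have hFint : ∀ s, ∫⁻ l, F s l ∂ν = f s ^ p := fun s => lintegral_Ioi_ite_ofReal_lt _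
  have hF01 : ∀ l s, F s l = 0 ∨ F s l = 1 := by
    intro l s; simp only [hF]; split_ifs <;> simp
  have hFpow : ∀ s l, F s l ^ (1 / p) = F s l := by
    intro s l
    rcases hF01 l s with h | h <;> simp [h, hp]
  have hFmono : ∀ l, MonotoneOn (fun s => F s l) (io a b) := by
    intro l s hs t ht hst
    have := ENNReal.rpow_le_rpow (hf hs ht hst) hp.le
    simp only [hF]
    split_ifs with h1 h2
    · exact le_rfl
    · exact absurd (h1.trans_le this) h2
    · exact zero_le
    · exact le_rfl
  set A : ℝ → ℝ → ℝ≥0∞ := fun t l => ∫⁻ s in io a t, F s l * u s with hA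
  have hAm : Measurable (Function.uncurry A) := by
    have e : Function.uncurry A = fun z : ℝ × ℝ => ∫⁻ s,
        {y : (ℝ × ℝ) × ℝ | a < (y.2 : EReal) ∧ y.2 < y.1.1}.indicator
          (fun y => F y.2 y.1.2 * u y.2) (z, s) := by
      ext ⟨t, l⟩
      simp only [Function.uncurry, hA]
      rw [← lintegral_indicator (measurableSet_io _ _)]
      refine lintegral_congr fun s => ?_
      simp [indicator_apply, io]
    rw [e]
    refine Measurable.lintegral_prod_right' (Measurable.indicator ?_ ?_)
    · exact (hFm.comp (measurable_snd.prodMk (measurable_snd.comp measurable_fst))).mul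
        (hu.1.comp measurable_snd)
    · exact (measurableSet_lt measurable_const (measurable_coe_real_ereal.comp measurable_snd)).inter
        (measurableSet_lt measurable_snd (measurable_fst.comp measurable_fst))
  have hinner : ∀ t ∈ io a b, ∫⁻ s in io a t, f s * u s ≤ (∫⁻ l, A t l ^ p ∂ν) ^ (1 / p) := by
    intro t ht
    have := setLIntegral_lintegral_rpow_mul_le (μ := volume) (ν := ν) hFm
      (r := 1 / p) ((one_le_div hp).2 hp1) (measurableSet_io a t) hu.1
      fun s hs => (hu.2 s (io_subset_io le_rfl ht.2.le hs)).2.ne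
    simp only [hFint, hFpow, ← ENNReal.rpow_mul, one_div_one_div] at this
    simpa [hp.ne'] using this
  have hqp : 0 < q / p := by positivity
  have houter : ∫⁻ t in io a b, (∫⁻ s in io a t, f s * u s) ^ q * w t ≤
      (K ^ p * ∫⁻ s in io a b, f s ^ p * v s) ^ (q / p) := by
    calc _ ≤ ∫⁻ t in io a b, (∫⁻ l, A t l ^ p ∂ν) ^ (q / p) * w t := by
          refine setLIntegral_mono' (measurableSet_io a b) fun t ht => ?_
          gcongr
          calc _ ≤ ((∫⁻ l, A t l ^ p ∂ν) ^ (1 / p)) ^ q := by gcongr; exact hinner t ht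
            _ = _ := by rw [← ENNReal.rpow_mul]; congr 1; field_simp
      _ ≤ (∫⁻ l, (∫⁻ t in io a b, (A t l ^ p) ^ (q / p) * w t) ^ (1 / (q / p)) ∂ν) ^ (q / p) :=
          setLIntegral_lintegral_rpow_mul_le (hAm.pow_const p) ((one_le_div hp).2 hpq)
            (measurableSet_io a b) hw.1 fun t ht => (hw.2 t ht).2.ne
      _ ≤ (∫⁻ l, K ^ p * (∫⁻ s in io a b, F s l * v s) ∂ν) ^ (q / p) := by
          gcongr with l
          rw [one_div, ENNReal.rpow_inv_le_iff hqp]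
          have e : p * (q / p) = q := by field_simp
          simp only [← ENNReal.rpow_mul, e]
          exact hardy_indicator_le hp hq hu hv hw hK hCK (hF01 l) (hFmono l)
      _ = _ := by
          congr 1
          have hm : Measurable (Function.uncurry fun l s => F s l * v s) :=
            (hFm.comp measurable_swap).mul (hv.1.comp measurable_snd)
          have hm' : Measurable fun l => ∫⁻ s in io a b, F s l * v s := hm.lintegral_prod_right'
          rw [lintegral_const_mul _ hm',
            lintegral_lintegral_swap hm.aemeasurable]
          congr 1
          refine lintegral_congr fun s => ?_
          rw [lintegral_mul_const _ hFm.of_uncurry_left, hFint]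
  calc lhsMon a b q u w f ≤ ((K ^ p * ∫⁻ s in io a b, f s ^ p * v s) ^ (q / p)) ^ (1 / q) :=
        ENNReal.rpow_le_rpow houter (by positivity)
    _ = K * rhsNorm a b p v f := by
        have e : q / p * (1 / q) = 1 / p := by field_simp
        rw [← ENNReal.rpow_mul, e, ENNReal.mul_rpow_of_nonneg _ _ (by positivity),
          ← ENNReal.rpow_mul, mul_one_div_cancel hp.ne', ENNReal.rpow_one, rhsNorm]

/-- Necessity: every admissible constant dominates `CC1`. -/
lemma CC1_le_of_forall_lhsMon_le {a b : EReal} {p q : ℝ} (hp : 0 < p) (hq : 0 < q)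
    {u v w : ℝ → ℝ≥0∞} (hv : IsWeight a b v) {C : ℝ≥0∞}
    (hC : ∀ f : ℝ → ℝ≥0∞, Measurable f → MonotoneOn f (io a b) →
      lhsMon a b q u w f ≤ C * rhsNorm a b p v f) :
    CC1 a b p q u v w ≤ C := by
  refine essSup_le_of_ae_le _ ?_
  filter_upwards [ae_restrict_mem (measurableSet_io a b)] with x hx
  set V := ∫⁻ t in io x b, v t with hV
  have hxab : io x b ⊆ io a b := io_subset_io hx.1.le le_rfl
  have hV0 : V ≠ 0 := setLIntegral_io_ne_zero hx.2 hv.1 fun t ht => (hv.2 t (hxab ht)).1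
  rcases eq_or_ne V ⊤ with hVt | hVt
  · simp [hVt, hp]
  rw [ENNReal.rpow_neg, ← div_eq_mul_inv, ENNReal.div_le_iff
    (by simp [ENNReal.rpow_eq_zero_iff, hV0, hVt]) (by simp [ENNReal.rpow_eq_top_iff, hV0, hVt])]
  have hm : Monotone ((Ioi x).indicator (1 : ℝ → ℝ≥0∞)) := by
    intro s t hst
    by_cases hs : x < s
    · simp [hs, hs.trans_le hst]
    · simp [hs]
  refine le_trans ?_ ((hC ((Ioi x).indicator 1) (measurable_one.indicator measurableSet_Ioi)
    (hm.monotoneOn _)).trans ?_)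
  · refine ENNReal.rpow_le_rpow ?_ (by positivity)
    refine (setLIntegral_mono' (measurableSet_io _ _) fun t ht => ?_).trans (lintegral_mono_set hxab)
    rw [mul_comm]
    refine mul_le_mul_left (ENNReal.rpow_le_rpow ?_ hq.le) _
    refine (setLIntegral_mono' (measurableSet_io _ _) fun s hs => ?_).trans
      (lintegral_mono_set (io_subset_io hx.1.le le_rfl))
    have : x < s := by exact_mod_cast hs.1
    simp [this]
  · refine mul_le_mul_right (ENNReal.rpow_le_rpow ?_ (by positivity)) _
    rw [hV, ← lintegral_indicator (measurableSet_io _ _), ← lintegral_indicator (measurableSet_io _ _)]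
    refine lintegral_mono fun t => ?_
    by_cases ht : t ∈ io a b
    · by_cases hxt : x < t
      · have : t ∈ io x b := ⟨by exact_mod_cast hxt, ht.2⟩
        simp [ht, hxt, this]
      · simp [ht, hxt, hp]
    · simp [ht]

theorem monotone_hardy_case_i (p q : ℝ) (hp : 0 < p) (hq : 0 < q)
    (hpq : p ≤ q) (hp1 : p ≤ 1) :
    ∃ c₁ c₂ : ℝ≥0∞, 0 < c₁ ∧ c₂ < ⊤ ∧
      ∀ (a b : EReal), a < b → ∀ u v w : ℝ → ℝ≥0∞,
        IsWeight a b u → IsWeight a b v → IsWeight a b w →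
        ((∃ C : ℝ≥0∞, 0 < C ∧ C < ⊤ ∧ ∀ f : ℝ → ℝ≥0∞,
            Measurable f → MonotoneOn f (io a b) →
            lhsMon a b q u w f ≤ C * rhsNorm a b p v f) ↔
          CC1 a b p q u v w < ⊤) ∧
        c₁ * CC1 a b p q u v w ≤ bestMon a b p q u v w ∧
        bestMon a b p q u v w ≤ c₂ * CC1 a b p q u v w := by
  refine ⟨1, 1, one_pos, one_lt_top, fun a b _ u v w hu hv hw => ⟨⟨?_, fun h => ?_⟩, ?_, ?_⟩⟩
  · rintro ⟨C, _, hCt, hC⟩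
    exact (CC1_le_of_forall_lhsMon_le hp hq hv hC).trans_lt hCt
  · exact ⟨CC1 a b p q u v w + 1, by simp, ENNReal.add_lt_top.2 ⟨h, one_lt_top⟩,
      fun f => lhsMon_le_mul_rhsNorm hp hq hpq hp1 hu hv hw (by simp) le_self_add⟩
  · rw [one_mul]
    exact le_sInf fun C hC => CC1_le_of_forall_lhsMon_le hp hq hv hC
  · rw [one_mul]
    refine le_of_forall_gt fun K hK => ?_
    obtain ⟨K', hK', hK'K⟩ := exists_between hK
    refine lt_of_le_of_lt (sInf_le ?_) hK'K
    exact fun f => lhsMon_le_mul_rhsNorm hp hq hpq hp1 hu hv hw (zero_le.trans_lt hK') hK'.le
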